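/- The asymptotic period d(X) of a birth-death process X equals 1, 2, or ∞. -/

import Mathlib

open MeasureTheory Filter Set ProbabilityTheory

/-- A discrete-time Markov chain on a state space `S`: a stochastic transition
matrix `P`, an initial distribution `init`, and the induced probability measure
`μ` on the path space `ℕ → S`, determined by its values on cylinder sets. -/
structure MarkovChain (S : Type) [MeasurableSpace S] where
  P : S → S → ℝ
  P_nonneg : ∀ i j, 0 ≤ P i j
  P_stochastic : ∀ i, HasSum (P i) 1
  init : S → ℝ
  init_nonneg : ∀ i, 0 ≤ init i
  init_hasSum : HasSum init 1
  μ : Measure (ℕ → S)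
  μ_prob : IsProbabilityMeasure μ
  μ_cylinder : ∀ (n : ℕ) (s : ℕ → S),
    μ {ω | ∀ k ≤ n, ω k = s k}
      = ENNReal.ofReal (init (s 0) * ∏ k ∈ Finset.range n, P (s k) (s (k + 1)))

namespace MarkovChain

variable {S : Type} [MeasurableSpace S]

open Classical in
/-- The `n`-step transition probabilities `P^n(i,j)`. -/
noncomputable def Pn (X : MarkovChain S) : ℕ → S → S → ℝ
  | 0, i, j => if i = j then 1 else 0
  | n + 1, i, j => ∑' k : S, X.Pn n i k * X.P k j

/-- Irreducibility: every state can be reached from every state. -/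
def Irreducible (X : MarkovChain S) : Prop := ∀ i j : S, ∃ n : ℕ, 0 < X.Pn n i j

/-- Aperiodicity: for each state, the gcd of the set `{n ≥ 1 | P^n(i,i) > 0}`
is `1` (expressed via common divisors). -/
def Aperiodic (X : MarkovChain S) : Prop :=
  ∀ i : S, ∀ d : ℕ, (∀ n : ℕ, 0 < n → 0 < X.Pn n i i → d ∣ n) → d = 1

/-- `U^(m)(C)`: the event that the `m`-step chain visits `C` infinitely often. -/
def U (X : MarkovChain S) (m : ℕ) (C : Set S) : Set (ℕ → S) :=
  {ω | ∀ n : ℕ, ∃ k : ℕ, n ≤ k ∧ ω (k * m) ∈ C}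

/-- `L^(m)(C)`: the event that the `m`-step chain is eventually in `C`. -/
def L (X : MarkovChain S) (m : ℕ) (C : Set S) : Set (ℕ → S) :=
  {ω | ∃ n : ℕ, ∀ k : ℕ, n ≤ k → ω (k * m) ∈ C}

/-- `C` is transient with respect to the `m`-step chain `X^(m)`. -/
def Transient (X : MarkovChain S) (m : ℕ) (C : Set S) : Prop := X.μ (X.U m C) = 0

/-- `C` is regular with respect to `X^(m)`: `U^(m)(C)` and `L^(m)(C)` agree up
to a null event. -/
def Regular (X : MarkovChain S) (m : ℕ) (C : Set S) : Prop :=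
  X.μ (symmDiff (X.U m C) (X.L m C)) = 0

/-- `C` is almost closed with respect to `X^(m)`: regular but not transient. -/
def AlmostClosed (X : MarkovChain S) (m : ℕ) (C : Set S) : Prop :=
  X.Regular m C ∧ ¬ X.Transient m C

/-- An almost closed set is atomic if it does not contain two disjoint almost
closed subsets. -/
def Atomic (X : MarkovChain S) (m : ℕ) (C : Set S) : Prop :=
  X.AlmostClosed m C ∧
    ¬ ∃ A B : Set S, A ⊆ C ∧ B ⊆ C ∧ Disjoint A B ∧
      X.AlmostClosed m A ∧ X.AlmostClosed m B

/-- A Blackwell decomposition for the `m`-step chain `X^(m)`: a countable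
collection of pairwise disjoint almost closed sets, all atomic except at most
one, where a nonatomic member contains no atomic subsets and consists of
transient states, and such that the probabilities `μ(L^(m)(C))` sum to one. -/
structure IsBlackwell (X : MarkovChain S) (m : ℕ) (𝒞 : Set (Set S)) : Prop where
  countable : 𝒞.Countable
  almostClosed : ∀ C ∈ 𝒞, X.AlmostClosed m C
  disjoint : 𝒞.PairwiseDisjoint id
  atMostOneNonatomic : ∀ C₁ ∈ 𝒞, ∀ C₂ ∈ 𝒞, ¬ X.Atomic m C₁ → ¬ X.Atomic m C₂ → C₁ = C₂
  nonatomicNoAtomicSubset : ∀ C ∈ 𝒞, ¬ X.Atomic m C → ∀ A : Set S, A ⊆ C → ¬ X.Atomic m A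
  nonatomicTransientStates : ∀ C ∈ 𝒞, ¬ X.Atomic m C → ∀ i ∈ C, X.Transient m {i}
  sum_L_eq_one : ∑' C : 𝒞, X.μ (X.L m (C : Set S)) = 1

/-- `β(X^(m))`: the number of sets in a Blackwell decomposition for `X^(m)`
(well defined since the decomposition is unique up to equivalence). -/
noncomputable def beta (X : MarkovChain S) (m : ℕ) : ℕ∞ :=
  sInf (Set.encard '' {𝒞 : Set (Set S) | X.IsBlackwell m 𝒞})

/-- `X` is simple if `β(X) = 1`. -/
def Simple (X : MarkovChain S) : Prop := X.beta 1 = 1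

/-- The asymptotic period `d(X) = sup {m ≥ 1 | β(X^(m)) = m}` (possibly `∞`). -/
noncomputable def period (X : MarkovChain S) : ℕ∞ :=
  sSup {d : ℕ∞ | ∃ m : ℕ, 1 ≤ m ∧ X.beta m = (m : ℕ∞) ∧ d = (m : ℕ∞)}

/-- Recurrence: every state is visited infinitely often almost surely. -/
def Recurrent (X : MarkovChain S) : Prop := ∀ i : S, X.μ (X.U 1 {i}) = 1

end MarkovChain

/-- The shift operator `θ` on path space: `(θ ω)(n) = ω(n+1)`. -/
def pathShift {S : Type} : (ℕ → S) → ℕ → S := fun ω n => ω (n + 1)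

/-- An event `E` is `m`-invariant if its indicator function `f` satisfies
`f(ω) = f(θ^m ω)` for all paths `ω`. -/
def MInvariant {S : Type} (m : ℕ) (E : Set (ℕ → S)) : Prop :=
  ∀ ω : ℕ → S, ω ∈ E ↔ pathShift^[m] ω ∈ E

/-- A birth-death process: a Markov chain on `ℕ` with positive birth
probabilities `p_i = P(i,i+1)`, positive death probabilities `q_{i+1} = P(i+1,i)`,
all transition probabilities other than `p_i`, `q_i` and `r_i = P(i,i)` zero,
and at least one positive self-transition probability. -/
structure MarkovChain.IsBirthDeath (X : MarkovChain ℕ) : Prop where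
  birth_pos : ∀ i : ℕ, 0 < X.P i (i + 1)
  death_pos : ∀ i : ℕ, 0 < X.P (i + 1) i
  tridiagonal : ∀ i j : ℕ, 1 < |(i : ℤ) - (j : ℤ)| → X.P i j = 0
  self_pos : ∃ i : ℕ, 0 < X.P i i

namespace MarkovChain

section Markov

variable (X : MarkovChain ℕ)

instance isProbabilityMeasure_μ : IsProbabilityMeasure X.μ := X.μ_prob

theorem measurableSet_eval_mem (n : ℕ) (C : Set ℕ) : MeasurableSet {ω : ℕ → ℕ | ω n ∈ C} :=
  measurable_pi_apply n (MeasurableSet.of_discrete (s := C))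

theorem measurableSet_eval_eq (n i : ℕ) : MeasurableSet {ω : ℕ → ℕ | ω n = i} :=
  measurableSet_eval_mem n {i}

/-- Conditionally on a past that ends in `a`, the next state is `b` with probability `P a b`. -/
theorem μ_inter_next {N a : ℕ} {A : Set (ℕ → ℕ)} (hA : MeasurableSet[Filtration.piLE N] A)
    (hAa : ∀ ω ∈ A, ω N = a) (b : ℕ) :
    X.μ (A ∩ {ω | ω (N + 1) = b}) = X.μ A * ENNReal.ofReal (X.P a b) := by
  have hρ : Measurable (Preorder.restrictLe (π := fun _ : ℕ => ℕ) N) :=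
    Preorder.measurable_restrictLe N
  have key : (X.μ.restrict ({ω | ω N = a} ∩ {ω | ω (N + 1) = b})).map
        (Preorder.restrictLe (π := fun _ : ℕ => ℕ) N)
      = ENNReal.ofReal (X.P a b) • (X.μ.restrict {ω | ω N = a}).map
        (Preorder.restrictLe (π := fun _ : ℕ => ℕ) N) := by
    refine Measure.ext_of_singleton fun t => ?_
    rw [Measure.smul_apply, Measure.map_apply hρ (measurableSet_singleton t),
      Measure.map_apply hρ (measurableSet_singleton t),
      Measure.restrict_apply (hρ (measurableSet_singleton t)),
      Measure.restrict_apply (hρ (measurableSet_singleton t))]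
    by_cases hta : t ⟨N, le_refl N⟩ = a
    · set s : ℕ → ℕ := fun k => if h : k ≤ N then t ⟨k, h⟩ else b with hs
      have h1 : Preorder.restrictLe (π := fun _ : ℕ => ℕ) N ⁻¹' {t} ∩
          ({ω | ω N = a} ∩ {ω | ω (N + 1) = b}) = {ω | ∀ k ≤ N + 1, ω k = s k} := by
        ext ω
        constructor
        · rintro ⟨h, -, h2⟩ k hk
          rcases Nat.lt_or_ge N k with h3 | h3
          · obtain rfl : k = N + 1 := by omega
            simpa [hs] using h2
          · have := congrFun h ⟨k, h3⟩
            simpa [hs, h3] using this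
        · intro h
          refine ⟨?_, ?_, ?_⟩
          · funext k
            have h3 : (k : ℕ) ≤ N := k.2
            have := h k (by omega)
            simpa [hs, h3] using this
          · have := h N (by omega)
            simpa [hs, hta] using this
          · have := h (N + 1) le_rfl
            simpa [hs] using this
      have h2 : Preorder.restrictLe (π := fun _ : ℕ => ℕ) N ⁻¹' {t} ∩ {ω | ω N = a}
          = {ω | ∀ k ≤ N, ω k = s k} := by
        ext ω
        constructor
        · rintro ⟨h, -⟩ k hk
          have := congrFun h ⟨k, hk⟩
          simpa [hs, hk] using this
        · intro h
          refine ⟨?_, ?_⟩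
          · funext k
            have h3 : (k : ℕ) ≤ N := k.2
            have := h k h3
            simpa [hs, h3] using this
          · have := h N le_rfl
            simpa [hs, hta] using this
      have hsN : s N = a := by simp [hs, hta]
      have hsN1 : s (N + 1) = b := by simp [hs]
      rw [h1, h2, X.μ_cylinder, X.μ_cylinder, Finset.prod_range_succ, ← mul_assoc, hsN, hsN1,
        ENNReal.ofReal_mul' (X.P_nonneg a b), smul_eq_mul, mul_comm]
    · have h2 : Preorder.restrictLe (π := fun _ : ℕ => ℕ) N ⁻¹' {t} ∩ {ω | ω N = a} = ∅ := by
        ext ω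
        simp only [mem_inter_iff, mem_empty_iff_false, iff_false, not_and]
        intro h h'
        exact hta ((congrFun h ⟨N, le_refl N⟩).symm.trans h')
      rw [← inter_assoc, h2, empty_inter, measure_empty, smul_zero]
  obtain ⟨B, hB, rfl⟩ := hA
  have h := congrArg (fun ν => ν B) key
  simp only [Measure.smul_apply] at h
  rw [Measure.map_apply hρ hB, Measure.map_apply hρ hB, Measure.restrict_apply (hρ hB),
    Measure.restrict_apply (hρ hB), smul_eq_mul, ← inter_assoc] at h
  rw [inter_eq_left.mpr (show _ ⊆ {ω : ℕ → ℕ | ω N = a} from hAa)] at h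
  rw [h, mul_comm]

theorem measurableSet_piLE_eval_mem {n N : ℕ} (h : n ≤ N) (C : Set ℕ) :
    MeasurableSet[Filtration.piLE N] {ω : ℕ → ℕ | ω n ∈ C} := by
  refine ⟨{t | t ⟨n, h⟩ ∈ C}, measurable_pi_apply _ (MeasurableSet.of_discrete (s := C)), rfl⟩

/-- Two finite measures on path space that agree on cylinders are equal. -/
theorem ext_of_cylinder {ν₁ ν₂ : Measure (ℕ → ℕ)} [IsFiniteMeasure ν₁]
    (h : ∀ (n : ℕ) (s : ℕ → ℕ), ν₁ {ω | ∀ k ≤ n, ω k = s k} = ν₂ {ω | ∀ k ≤ n, ω k = s k}) :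
    ν₁ = ν₂ := by
  have hmap : ∀ n, ν₁.map (Preorder.restrictLe (π := fun _ : ℕ => ℕ) n)
      = ν₂.map (Preorder.restrictLe (π := fun _ : ℕ => ℕ) n) := by
    intro n
    refine Measure.ext_of_singleton fun t => ?_
    have hρ : Measurable (Preorder.restrictLe (π := fun _ : ℕ => ℕ) n) :=
      Preorder.measurable_restrictLe n
    rw [Measure.map_apply hρ (measurableSet_singleton t),
      Measure.map_apply hρ (measurableSet_singleton t)]
    set s : ℕ → ℕ := fun k => if h : k ≤ n then t ⟨k, h⟩ else 0 with hs
    have h2 : Preorder.restrictLe (π := fun _ : ℕ => ℕ) n ⁻¹' {t}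
        = {ω | ∀ k ≤ n, ω k = s k} := by
      ext ω
      constructor
      · intro h k hk
        have := congrFun h ⟨k, hk⟩
        simpa [hs, hk] using this
      · intro h
        funext k
        have h3 : (k : ℕ) ≤ n := k.2
        have := h k h3
        simpa [hs, h3] using this
    rw [h2, h n s]
  have hpi : ∀ n, ∀ A, MeasurableSet[Filtration.piLE n] A → ν₁ A = ν₂ A := by
    rintro n _ ⟨B, hB, rfl⟩
    have := congrArg (fun ν => ν B) (hmap n)
    rw [Measure.map_apply (Preorder.measurable_restrictLe (X := fun _ : ℕ => ℕ) n) hB,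
      Measure.map_apply (Preorder.measurable_restrictLe (X := fun _ : ℕ => ℕ) n) hB] at this
    exact this
  refine ext_of_generate_finite {A | ∃ n, MeasurableSet[Filtration.piLE n] A} ?_ ?_ ?_ ?_
  · apply le_antisymm
    · refine iSup_le fun n => ?_
      rintro _ ⟨C, hC, rfl⟩
      exact MeasurableSpace.measurableSet_generateFrom
        ⟨n, measurableSet_piLE_eval_mem le_rfl C⟩
    · refine MeasurableSpace.generateFrom_le ?_
      rintro A ⟨n, hA⟩
      exact Filtration.piLE.le n A hA
  · rintro A ⟨n, hA⟩ B ⟨k, hB⟩ -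
    exact ⟨max n k, (Filtration.piLE.mono (le_max_left n k) A hA).inter
      (Filtration.piLE.mono (le_max_right n k) B hB)⟩
  · rintro A ⟨n, hA⟩
    exact hpi n A hA
  · exact hpi 0 univ MeasurableSet.univ

theorem measurable_shift (n : ℕ) : Measurable fun (ω : ℕ → ℕ) k => ω (k + n) :=
  measurable_pi_lambda _ fun k => measurable_pi_apply (k + n)

open Classical in
theorem μ_shift_cylinder (n i k : ℕ) (s : ℕ → ℕ) :
    X.μ ({ω | ω n = i} ∩ {ω | ∀ l ≤ k, ω (l + n) = s l})
      = X.μ {ω | ω n = i} * ((if s 0 = i then 1 else 0) *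
        ∏ l ∈ Finset.range k, ENNReal.ofReal (X.P (s l) (s (l + 1)))) := by
  induction k with
  | zero =>
    split_ifs with h
    · simp only [Finset.range_zero, Finset.prod_empty, mul_one]
      congr 1
      ext ω
      simp [h]
    · simp only [zero_mul, mul_zero]
      convert measure_empty (μ := X.μ)
      ext ω
      simp only [mem_inter_iff, mem_empty_iff_false, iff_false, not_and]
      intro h1 h2
      have := h2 0 le_rfl
      simp only [zero_add] at this
      exact h (this.symm.trans h1)
  | succ k ih =>
    have h1 : {ω : ℕ → ℕ | ω n = i} ∩ {ω | ∀ l ≤ k + 1, ω (l + n) = s l}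
        = ({ω | ω n = i} ∩ {ω | ∀ l ≤ k, ω (l + n) = s l}) ∩ {ω | ω (k + n + 1) = s (k + 1)} := by
      ext ω
      simp only [mem_inter_iff, mem_ofPred_eq, and_assoc, and_congr_right_iff]
      intro _
      constructor
      · intro h
        refine ⟨fun l hl => h l (by omega), ?_⟩
        have := h (k + 1) le_rfl
        rwa [show k + 1 + n = k + n + 1 by omega] at this
      · rintro ⟨h, h'⟩ l hl
        rcases Nat.lt_or_ge k l with h3 | h3
        · obtain rfl : l = k + 1 := by omega
          rwa [show k + 1 + n = k + n + 1 by omega]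
        · exact h l h3
    have hm : MeasurableSet[Filtration.piLE (k + n)]
        ({ω : ℕ → ℕ | ω n = i} ∩ {ω | ∀ l ≤ k, ω (l + n) = s l}) := by
      refine MeasurableSet.inter (measurableSet_piLE_eval_mem (by omega) {i}) ?_
      have : {ω : ℕ → ℕ | ∀ l ≤ k, ω (l + n) = s l}
          = ⋂ l, ⋂ (_ : l ≤ k), {ω | ω (l + n) ∈ ({s l} : Set ℕ)} := by
        ext ω; simp
      rw [this]
      exact MeasurableSet.iInter fun l => MeasurableSet.iInter fun hl =>
        measurableSet_piLE_eval_mem (by omega) {s l}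
    rw [h1, X.μ_inter_next hm (a := s k) (fun ω hω => hω.2 k le_rfl), ih, Finset.prod_range_succ]
    ring

/-- The Markov property: the law of the chain after a visit to `i` does not depend on the time of
the visit. -/
theorem μ_shift_comm (n l i : ℕ) {N : Set (ℕ → ℕ)} (hN : MeasurableSet N) :
    X.μ {ω | ω l = i} * X.μ ({ω | ω n = i} ∩ {ω | (fun k => ω (k + n)) ∈ N})
      = X.μ {ω | ω n = i} * X.μ ({ω | ω l = i} ∩ {ω | (fun k => ω (k + l)) ∈ N}) := by
  classical
  have hval : ∀ n (A : Set (ℕ → ℕ)), MeasurableSet A →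
      ((X.μ.restrict {ω | ω n = i}).map fun (ω : ℕ → ℕ) k => ω (k + n)) A
        = X.μ ({ω | ω n = i} ∩ {ω | (fun k => ω (k + n)) ∈ A}) := by
    intro n A hA
    rw [Measure.map_apply (measurable_shift n) hA,
      Measure.restrict_apply (measurable_shift n hA), inter_comm]
    rfl
  have hcyl : ∀ (n : ℕ) (s : ℕ → ℕ), MeasurableSet {ω : ℕ → ℕ | ∀ k ≤ n, ω k = s k} := by
    intro n s
    have : {ω : ℕ → ℕ | ∀ k ≤ n, ω k = s k} = ⋂ k, ⋂ (_ : k ≤ n), {ω | ω k = s k} := by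
      ext ω; simp
    rw [this]
    exact MeasurableSet.iInter fun k => MeasurableSet.iInter fun _ => measurableSet_eval_eq k _
  have hfin : IsFiniteMeasure (X.μ {ω | ω l = i} •
      (X.μ.restrict {ω | ω n = i}).map fun (ω : ℕ → ℕ) k => ω (k + n)) :=
    Measure.smul_finite _ (measure_ne_top _ _)
  have key : X.μ {ω | ω l = i} • ((X.μ.restrict {ω | ω n = i}).map fun (ω : ℕ → ℕ) k => ω (k + n))
      = X.μ {ω | ω n = i} •
        ((X.μ.restrict {ω | ω l = i}).map fun (ω : ℕ → ℕ) k => ω (k + l)) := by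
    refine ext_of_cylinder fun k s => ?_
    rw [Measure.smul_apply, Measure.smul_apply, hval n _ (hcyl k s), hval l _ (hcyl k s)]
    have h1 := X.μ_shift_cylinder n i k s
    have h2 := X.μ_shift_cylinder l i k s
    simp only [mem_ofPred_eq, smul_eq_mul] at h1 h2 ⊢
    rw [h1, h2]
    ring
  have := congrArg (fun ν => ν N) key
  simpa only [Measure.smul_apply, hval _ _ hN, smul_eq_mul] using this

theorem condExp_next (j k : ℕ) :
    (fun ω : ℕ → ℕ => X.P (ω k) j) =ᵐ[X.μ]
      X.μ[({ω : ℕ → ℕ | ω (k + 1) = j}).indicator (1 : (ℕ → ℕ) → ℝ) | Filtration.piLE k] := by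
  have hle : ∀ a b, X.P a b ≤ 1 := fun a b =>
    le_hasSum (X.P_stochastic a) b fun c _ => X.P_nonneg a c
  have hmeas : Measurable[Filtration.piLE (X := fun _ : ℕ => ℕ) k] fun ω : ℕ → ℕ => X.P (ω k) j := by
    intro T _
    exact measurableSet_piLE_eval_mem le_rfl {a | X.P a j ∈ T}
  have hmeas' : Measurable fun ω : ℕ → ℕ => X.P (ω k) j :=
    hmeas.mono (Filtration.piLE.le k) le_rfl
  have hint : Integrable (fun ω : ℕ → ℕ => X.P (ω k) j) X.μ := by
    refine Integrable.of_bound hmeas'.aestronglyMeasurable 1 (ae_of_all _ fun ω => ?_)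
    rw [Real.norm_of_nonneg (X.P_nonneg _ _)]
    exact hle _ _
  refine ae_eq_condExp_of_forall_setIntegral_eq (Filtration.piLE.le k) ?_ ?_ ?_ ?_
  · exact (integrable_const (1 : ℝ)).indicator (measurableSet_eval_eq _ _)
  · intro A _ _
    exact hint.integrableOn
  · intro A hA _
    have hA' : MeasurableSet A := Filtration.piLE.le k A hA
    rw [integral_eq_lintegral_of_nonneg_ae (ae_of_all _ fun ω => X.P_nonneg _ _)
      hmeas'.aestronglyMeasurable]
    rw [integral_indicator_one (measurableSet_eval_eq _ _), Measure.real,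
      Measure.restrict_apply (measurableSet_eval_eq _ _)]
    congr 1
    have hU : A = ⋃ a, A ∩ {ω | ω k = a} := by
      ext ω; simp
    have hdisj : Pairwise (Function.onFun Disjoint fun a => A ∩ {ω : ℕ → ℕ | ω k = a}) := by
      intro a b hab
      refine Set.disjoint_left.mpr ?_
      rintro ω ⟨-, h1⟩ ⟨-, h2⟩
      exact hab (h1.symm.trans h2)
    have hm : ∀ a, MeasurableSet (A ∩ {ω : ℕ → ℕ | ω k = a}) := fun a =>
      hA'.inter (measurableSet_eval_eq k a)
    have hR : {ω : ℕ → ℕ | ω (k + 1) = j} ∩ A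
        = ⋃ a, (A ∩ {ω | ω k = a}) ∩ {ω | ω (k + 1) = j} := by
      ext ω; simp [and_comm]
    rw [hR, measure_iUnion _ fun a => (hm a).inter (measurableSet_eval_eq _ _)]
    · conv_lhs => rw [hU]
      rw [lintegral_iUnion hm hdisj]
      refine tsum_congr fun a => ?_
      rw [X.μ_inter_next (a := a) (A := A ∩ {ω | ω k = a})
        (MeasurableSet.inter hA (measurableSet_piLE_eval_mem le_rfl {a})) (fun ω hω => hω.2),
        setLIntegral_congr_fun (hm a) (g := fun _ => ENNReal.ofReal (X.P a j)),
        setLIntegral_const, mul_comm]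
      intro ω hω
      simp only [show ω k = a from hω.2]
    · intro a b hab
      exact (hdisj hab).mono inter_subset_left inter_subset_left
  · exact hmeas.aestronglyMeasurable

/-- Almost surely, infinitely many visits to `i` produce infinitely many visits to every state
that can be reached from `i` in one step. -/
theorem ae_frequently_of_pos {i j : ℕ} (h : 0 < X.P i j) :
    ∀ᵐ ω ∂X.μ, (∃ᶠ n in atTop, ω n = i) → ∃ᶠ n in atTop, ω n = j := by
  have hLevy := ae_mem_limsup_atTop_iff (ℱ := Filtration.piLE (X := fun _ : ℕ => ℕ)) X.μ
    (s := fun n => {ω : ℕ → ℕ | ω n = j})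
    (fun n => measurableSet_piLE_eval_mem le_rfl {j})
  have hc := ae_all_iff.mpr (X.condExp_next j)
  filter_upwards [hLevy, hc] with ω h1 h2 hi
  have : ω ∈ limsup (fun n => {ω : ℕ → ℕ | ω n = j}) atTop := by
    rw [h1]
    simp only [← h2]
    refine (not_summable_iff_tendsto_nat_atTop_of_nonneg (fun n => X.P_nonneg _ _)).mp ?_
    intro hs
    have := hs.tendsto_atTop_zero.eventually (gt_mem_nhds h)
    obtain ⟨n, hn, hn'⟩ := (hi.and_eventually this).exists
    rw [hn] at hn'
    exact lt_irrefl _ hn'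
  rwa [mem_limsup_iff_frequently_mem] at this

end Markov

section Shift

variable {X : MarkovChain ℕ}

theorem μ_next_pos {n i j : ℕ} (hi : 0 < X.μ {ω | ω n = i}) (hij : 0 < X.P i j) :
    0 < X.μ {ω | ω (n + 1) = j} := by
  have h := X.μ_inter_next (N := n) (a := i) (A := {ω | ω n = i})
    (measurableSet_piLE_eval_mem le_rfl {i}) (fun _ h => h) j
  refine lt_of_lt_of_le ?_ (measure_mono (inter_subset_right (s := {ω : ℕ → ℕ | ω n = i})))
  rw [h]
  exact ENNReal.mul_pos hi.ne' (ENNReal.ofReal_pos.mpr hij).ne'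

theorem ae_P_pos (X : MarkovChain ℕ) : ∀ᵐ ω ∂X.μ, ∀ n, 0 < X.P (ω n) (ω (n + 1)) := by
  have : ∀ n i j, ∀ᵐ ω ∂X.μ, ω n = i → ω (n + 1) = j → 0 < X.P i j := by
    intro n i j
    rcases (X.P_nonneg i j).lt_or_eq with h | h
    · exact ae_of_all _ fun _ _ _ => h
    · have h1 := X.μ_inter_next (N := n) (a := i) (A := {ω | ω n = i})
        (measurableSet_piLE_eval_mem le_rfl {i}) (fun _ h => h) j
      rw [← h, ENNReal.ofReal_zero, mul_zero] at h1
      filter_upwards [measure_eq_zero_iff_ae_notMem.mp h1] with ω hω h2 h3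
      exact absurd ⟨h2, h3⟩ hω
  filter_upwards [ae_all_iff.mpr fun n => ae_all_iff.mpr fun i => ae_all_iff.mpr (this n i)]
    with ω hω n
  exact hω n _ _ rfl rfl

theorem IsBirthDeath.eventually_μ_pos (hbd : X.IsBirthDeath) (i : ℕ) :
    ∃ N, ∀ n ≥ N, 0 < X.μ {ω | ω n = i} := by
  obtain ⟨a, ha⟩ : ∃ a, 0 < X.μ {ω | ω 0 = a} := by
    by_contra! h
    have h0 : X.μ (⋃ a, {ω : ℕ → ℕ | ω 0 = a}) = 0 :=
      measure_iUnion_null fun a => le_antisymm (h a) zero_le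
    have hU : (⋃ a, {ω : ℕ → ℕ | ω 0 = a}) = univ := by ext ω; simp
    rw [hU, measure_univ] at h0
    exact one_ne_zero h0
  obtain ⟨s, hs⟩ := hbd.self_pos
  have up : ∀ d n a, 0 < X.μ {ω | ω n = a} → 0 < X.μ {ω | ω (n + d) = a + d} := by
    intro d n a h
    induction d with
    | zero => exact h
    | succ d ih => exact μ_next_pos ih (hbd.birth_pos _)
  have down : ∀ d n a, 0 < X.μ {ω | ω n = a + d} → 0 < X.μ {ω | ω (n + d) = a} := by
    intro d
    induction d with
    | zero => exact fun n a h => h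
    | succ d ih =>
      intro n a h
      have := ih (n + 1) a (μ_next_pos h (hbd.death_pos _))
      rwa [show n + (d + 1) = n + 1 + d by omega]
  have move : ∀ a b, ∃ d, ∀ n, 0 < X.μ {ω | ω n = a} → 0 < X.μ {ω | ω (n + d) = b} := by
    intro a b
    rcases le_total a b with h | h
    · refine ⟨b - a, fun n hn => ?_⟩
      simpa [Nat.add_sub_cancel' h] using up (b - a) n a hn
    · refine ⟨a - b, fun n hn => down (a - b) n b ?_⟩
      rwa [Nat.add_sub_cancel' h]
  obtain ⟨d₁, h₁⟩ := move a s
  obtain ⟨d₂, h₂⟩ := move s i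
  have loop : ∀ t, 0 < X.μ {ω | ω (0 + d₁ + t) = s} := by
    intro t
    induction t with
    | zero => exact h₁ 0 ha
    | succ t ih => exact μ_next_pos ih hs
  refine ⟨d₁ + d₂, fun n hn => ?_⟩
  have := h₂ _ (loop (n - d₁ - d₂))
  rwa [show 0 + d₁ + (n - d₁ - d₂) + d₂ = n by omega] at this

/-- A null event that is stable under the `m`-step shift stays null after shifts of any size. -/
theorem IsBirthDeath.μ_shift_null (hbd : X.IsBirthDeath) {m : ℕ} (hm : 1 ≤ m)
    {N : Set (ℕ → ℕ)} (hN : MeasurableSet N) (hN0 : X.μ N = 0)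
    (hinv : ∀ (ω : ℕ → ℕ) (t : ℕ), (fun k => ω (k + t * m)) ∈ N → ω ∈ N) (j : ℕ) :
    X.μ {ω | (fun k => ω (k + j)) ∈ N} = 0 := by
  have hU : {ω : ℕ → ℕ | (fun k => ω (k + j)) ∈ N}
      = ⋃ i, {ω | ω j = i} ∩ {ω | (fun k => ω (k + j)) ∈ N} := by
    ext ω; simp
  rw [hU]
  refine measure_iUnion_null fun i => ?_
  obtain ⟨T, hT⟩ := hbd.eventually_μ_pos i
  have hpos := hT (T * m) (Nat.le_mul_of_pos_right T hm)
  have h := X.μ_shift_comm j (T * m) i hN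
  have h0 : X.μ ({ω | ω (T * m) = i} ∩ {ω | (fun k => ω (k + T * m)) ∈ N}) = 0 :=
    measure_mono_null (fun ω hω => hinv ω T hω.2) hN0
  rw [h0, mul_zero] at h
  exact (mul_eq_zero.mp h).resolve_left hpos.ne'

end Shift

section Events

variable {X : MarkovChain ℕ} {m : ℕ} {A B C : Set ℕ}

theorem measurableSet_U (m : ℕ) (C : Set ℕ) : MeasurableSet (X.U m C) := by
  have : X.U m C = ⋂ n, ⋃ k, ⋃ (_ : n ≤ k), {ω | ω (k * m) ∈ C} := by
    ext ω; simp [U]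
  rw [this]
  exact MeasurableSet.iInter fun n => MeasurableSet.iUnion fun k => MeasurableSet.iUnion fun _ =>
    measurableSet_eval_mem _ C

theorem measurableSet_L (m : ℕ) (C : Set ℕ) : MeasurableSet (X.L m C) := by
  have : X.L m C = ⋃ n, ⋂ k, ⋂ (_ : n ≤ k), {ω | ω (k * m) ∈ C} := by
    ext ω; simp [L]
  rw [this]
  exact MeasurableSet.iUnion fun n => MeasurableSet.iInter fun k => MeasurableSet.iInter fun _ =>
    measurableSet_eval_mem _ C

theorem L_subset_U : X.L m C ⊆ X.U m C := by
  rintro ω ⟨n, hn⟩ N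
  exact ⟨max n N, le_max_right _ _, hn _ (le_max_left _ _)⟩

theorem U_mono (h : A ⊆ B) : X.U m A ⊆ X.U m B := by
  intro ω hω N
  obtain ⟨k, hk, hk'⟩ := hω N
  exact ⟨k, hk, h hk'⟩

theorem L_inter : X.L m A ∩ X.L m B ⊆ X.L m (A ∩ B) := by
  rintro ω ⟨⟨a, ha⟩, ⟨b, hb⟩⟩
  exact ⟨max a b, fun k hk => ⟨ha k ((le_max_left _ _).trans hk), hb k ((le_max_right _ _).trans hk)⟩⟩

theorem disjoint_L (h : Disjoint A B) : Disjoint (X.L m A) (X.L m B) := by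
  refine Set.disjoint_left.mpr fun ω h1 h2 => ?_
  obtain ⟨n, hn⟩ := L_inter ⟨h1, h2⟩
  exact Set.disjoint_left.mp h (hn n le_rfl).1 (hn n le_rfl).2

theorem regular_iff : X.Regular m C ↔ ∀ᵐ ω ∂X.μ, ω ∈ X.U m C → ω ∈ X.L m C := by
  rw [Regular, measure_eq_zero_iff_ae_notMem]
  refine eventually_congr (ae_of_all _ fun ω => ?_)
  rw [Set.mem_symmDiff]
  have := @L_subset_U X m C ω
  tauto

theorem transient_iff : X.Transient m C ↔ ∀ᵐ ω ∂X.μ, ω ∉ X.U m C :=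
  measure_eq_zero_iff_ae_notMem

theorem AlmostClosed.μ_L_ne_zero (h : X.AlmostClosed m C) : X.μ (X.L m C) ≠ 0 := by
  intro h0
  refine h.2 (transient_iff.mpr ?_)
  filter_upwards [regular_iff.mp h.1, measure_eq_zero_iff_ae_notMem.mp h0] with ω h1 h2 h3
  exact h2 (h1 h3)

theorem almostClosed_inter (hA : X.AlmostClosed m A) (hB : X.AlmostClosed m B)
    (h : X.μ (X.L m A ∩ X.L m B) ≠ 0) : X.AlmostClosed m (A ∩ B) := by
  refine ⟨regular_iff.mpr ?_, fun h0 => h ?_⟩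
  · filter_upwards [regular_iff.mp hA.1, regular_iff.mp hB.1] with ω h1 h2 h3
    exact L_inter ⟨h1 (U_mono inter_subset_left h3), h2 (U_mono inter_subset_right h3)⟩
  · exact measure_mono_null (L_inter.trans L_subset_U) h0

theorem IsBlackwell.ae_exists_mem_L {𝒟 : Set (Set ℕ)} (h : X.IsBlackwell m 𝒟) :
    ∀ᵐ ω ∂X.μ, ∃ C ∈ 𝒟, ω ∈ X.L m C := by
  have := h.countable.to_subtype
  have h1 : X.μ (⋃ C : 𝒟, X.L m (C : Set ℕ)) = 1 := by
    rw [measure_iUnion _ fun C => measurableSet_L m _, h.sum_L_eq_one]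
    intro C D hCD
    exact disjoint_L (h.disjoint C.2 D.2 (Subtype.coe_injective.ne hCD))
  have h2 := (prob_compl_eq_zero_iff
    (MeasurableSet.iUnion fun C : 𝒟 => measurableSet_L m (C : Set ℕ))).mpr h1
  filter_upwards [measure_eq_zero_iff_ae_notMem.mp h2] with ω hω
  simpa using hω

theorem sum_L_eq_one_of_ae {𝒟 : Set (Set ℕ)} (hc : 𝒟.Countable) (hd : 𝒟.PairwiseDisjoint id)
    (h : ∀ᵐ ω ∂X.μ, ∃ C ∈ 𝒟, ω ∈ X.L m C) : ∑' C : 𝒟, X.μ (X.L m (C : Set ℕ)) = 1 := by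
  have := hc.to_subtype
  rw [← measure_iUnion _ fun C : 𝒟 => measurableSet_L m (C : Set ℕ)]
  · refine (prob_compl_eq_zero_iff
      (MeasurableSet.iUnion fun C : 𝒟 => measurableSet_L m (C : Set ℕ))).mp ?_
    rw [measure_eq_zero_iff_ae_notMem]
    filter_upwards [h] with ω hω
    simpa using hω
  · intro C D hCD
    exact disjoint_L (hd C.2 D.2 (Subtype.coe_injective.ne hCD))

theorem atomic_of_subset (hB : X.Atomic m B) (hA : X.AlmostClosed m A) (h : A ⊆ B) :
    X.Atomic m A :=
  ⟨hA, fun ⟨A₁, A₂, h₁, h₂, h₃⟩ => hB.2 ⟨A₁, A₂, h₁.trans h, h₂.trans h, h₃⟩⟩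

/-- A decomposition into atomic sets has the smallest possible number of members. -/
theorem IsBlackwell.encard_le {𝒞 𝒟 : Set (Set ℕ)} (h𝒞 : X.IsBlackwell m 𝒞)
    (hat : ∀ C ∈ 𝒞, X.Atomic m C) (h𝒟 : X.IsBlackwell m 𝒟) : 𝒞.encard ≤ 𝒟.encard := by
  have hex : ∀ C ∈ 𝒞, ∃ D ∈ 𝒟, X.μ (X.L m C ∩ X.L m D) ≠ 0 := by
    intro C hC
    by_contra! h
    refine (h𝒞.almostClosed C hC).μ_L_ne_zero (measure_eq_zero_iff_ae_notMem.mpr ?_)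
    have h1 : ∀ᵐ ω ∂X.μ, ∀ D ∈ 𝒟, ω ∉ X.L m C ∩ X.L m D :=
      (ae_ball_iff h𝒟.countable).mpr fun D hD => measure_eq_zero_iff_ae_notMem.mp (h D hD)
    filter_upwards [h1, h𝒟.ae_exists_mem_L] with ω h2 ⟨D, hD, h3⟩ h4
    exact h2 D hD ⟨h4, h3⟩
  choose! g hg𝒟 hg using hex
  refine encard_le_encard_of_injOn (f := g) hg𝒟 fun C₁ h₁ C₂ h₂ he => ?_
  by_contra hne
  have hD := h𝒟.almostClosed _ (hg𝒟 C₁ h₁)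
  have a₁ := almostClosed_inter (h𝒞.almostClosed C₁ h₁) hD (hg C₁ h₁)
  have a₂ := almostClosed_inter (h𝒞.almostClosed C₂ h₂) hD (he ▸ hg C₂ h₂)
  have hna : ¬ X.Atomic m (g C₁) := fun h => h.2 ⟨_, _, inter_subset_right, inter_subset_right,
    (h𝒞.disjoint h₁ h₂ hne).mono inter_subset_left inter_subset_left, a₁, a₂⟩
  exact h𝒟.nonatomicNoAtomicSubset _ (hg𝒟 C₁ h₁) hna _ inter_subset_right
    (atomic_of_subset (hat C₁ h₁) a₁ inter_subset_left)

theorem IsBlackwell.beta_eq {𝒞 : Set (Set ℕ)} (h𝒞 : X.IsBlackwell m 𝒞)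
    (hat : ∀ C ∈ 𝒞, X.Atomic m C) : X.beta m = 𝒞.encard :=
  le_antisymm (sInf_le ⟨𝒞, h𝒞, rfl⟩)
    (le_sInf fun _ ⟨_, h𝒟, he⟩ => he ▸ h𝒞.encard_le hat h𝒟)

theorem isBlackwell_of_atomic {𝒞 : Set (Set ℕ)} (hc : 𝒞.Countable)
    (hat : ∀ C ∈ 𝒞, X.Atomic m C) (hd : 𝒞.PairwiseDisjoint id)
    (h : ∀ᵐ ω ∂X.μ, ∃ C ∈ 𝒞, ω ∈ X.L m C) : X.IsBlackwell m 𝒞 where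
  countable := hc
  almostClosed C hC := (hat C hC).1
  disjoint := hd
  atMostOneNonatomic C₁ h₁ _ _ h _ := absurd (hat C₁ h₁) h
  nonatomicNoAtomicSubset C hC h := absurd (hat C hC) h
  nonatomicTransientStates C hC h := absurd (hat C hC) h
  sum_L_eq_one := sum_L_eq_one_of_ae hc hd h

end Events

section Paths

variable {ω : ℕ → ℕ}

/-- A path with jumps of size at most one that goes to infinity, or is dense, visits every
infinite set infinitely often. -/
theorem frequently_mem_of_infinite (hskip : ∀ n, ω (n + 1) ≤ ω n + 1)
    (hlim : (∀ i, ∃ᶠ n in atTop, ω n = i) ∨ Tendsto ω atTop atTop) {C : Set ℕ}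
    (hC : C.Infinite) : ∃ᶠ n in atTop, ω n ∈ C := by
  rcases hlim with h | h
  · obtain ⟨c, hc⟩ := hC.nonempty
    exact (h c).mono fun n hn => hn ▸ hc
  · refine frequently_atTop.mpr fun N => ?_
    obtain ⟨c, hc, hNc⟩ := hC.exists_gt (ω N)
    have hex : ∃ k, c ≤ ω (N + k) := by
      obtain ⟨k, hk⟩ := ((h.eventually_ge_atTop c).and (eventually_ge_atTop N)).exists
      exact ⟨k - N, by rw [Nat.add_sub_cancel' hk.2]; exact hk.1⟩
    classical
    have h1 := Nat.find_spec hex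
    have h2 := @Nat.find_min _ _ hex
    set k := Nat.find hex
    refine ⟨N + k, Nat.le_add_right _ _, ?_⟩
    have : ω (N + k) = c := by
      rcases Nat.eq_zero_or_pos k with h0 | h0
      · rw [h0] at h1
        simp only [add_zero] at h1
        omega
      · have h3 := h2 (m := k - 1) (by omega)
        have h4 := hskip (N + (k - 1))
        rw [show N + (k - 1) + 1 = N + k by omega] at h4
        omega
    rwa [this]

/-- A path with jumps of size at most one that eventually never revisits a state after one or
two steps eventually only moves up. -/
theorem eventually_up (hup : ∀ n, ω (n + 1) ≤ ω n + 1) (hdown : ∀ n, ω n ≤ ω (n + 1) + 1)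
    {N : ℕ} (h : ∀ n ≥ N, ω (n + 1) ≠ ω n ∧ ω (n + 2) ≠ ω n) :
    ∃ M, ∀ n ≥ M, ω (n + 1) = ω n + 1 := by
  by_cases hex : ∃ n ≥ N, ω (n + 1) = ω n + 1
  · obtain ⟨M, hM, h0⟩ := hex
    refine ⟨M, fun n hn => ?_⟩
    induction n, hn using Nat.le_induction with
    | base => exact h0
    | succ n hn ih =>
      have h1 := hup (n + 1)
      have h2 := hdown (n + 1)
      have h3 := (h (n + 1) (by omega)).1
      have h4 := (h n (by omega)).2
      rw [show n + 2 = n + 1 + 1 by omega] at h4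
      omega
  · push Not at hex
    exfalso
    have : ∀ k, ω (N + k) + k = ω N := by
      intro k
      induction k with
      | zero => rfl
      | succ k ih =>
        have h1 := hup (N + k)
        have h2 := hdown (N + k)
        have h3 := (h (N + k) (by omega)).1
        have h4 := hex (N + k) (by omega)
        change ω (N + k + 1) + (k + 1) = ω N
        omega
    have := this (ω N + 1)
    omega

theorem exists_residue_mem_U {X : MarkovChain ℕ} {m : ℕ} (hm : 1 ≤ m) {C : Set ℕ}
    (h : ∃ᶠ n in atTop, ω n ∈ C) : ∃ j : Fin m, (fun k => ω (k + j)) ∈ X.U m C := by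
  by_contra! hno
  have hno' : ∀ j : Fin m, ∃ n : ℕ, ∀ k, n ≤ k → ω (k * m + j) ∉ C := by
    intro j
    have := hno j
    simpa [U] using this
  choose f hf using hno'
  obtain ⟨n, hn, hnC⟩ := frequently_atTop.mp h ((Finset.univ.sup f) * m)
  have hj := Nat.mod_lt n hm
  refine hf ⟨n % m, hj⟩ (n / m) ?_ ?_
  · exact (Finset.le_sup (Finset.mem_univ _)).trans ((Nat.le_div_iff_mul_le hm).mpr hn)
  · rwa [mul_comm, Nat.div_add_mod]

/-- If `m ≥ 3` disjoint regular sets are all visited infinitely often, then the path eventually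
only moves up. -/
theorem eventually_up_of_encard {X : MarkovChain ℕ} {m : ℕ} (hm : 3 ≤ m) {𝒟 : Set (Set ℕ)}
    (hcard : 𝒟.encard = m) (hd : 𝒟.PairwiseDisjoint id)
    (hup : ∀ n, ω (n + 1) ≤ ω n + 1) (hdown : ∀ n, ω n ≤ ω (n + 1) + 1)
    (hreg : ∀ C ∈ 𝒟, ∀ j : ℕ, (fun k => ω (k + j)) ∈ X.U m C → (fun k => ω (k + j)) ∈ X.L m C)
    (hvis : ∀ C ∈ 𝒟, ∃ᶠ n in atTop, ω n ∈ C) : ∃ M, ∀ n ≥ M, ω (n + 1) = ω n + 1 := by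
  have hfin : 𝒟.Finite := finite_of_encard_eq_coe hcard
  have := hfin.fintype
  have hcard' : Fintype.card 𝒟 = m := by
    have : 𝒟.encard = Fintype.card 𝒟 := by
      rw [encard, ENat.card_eq_coe_fintype_card]
    rw [this] at hcard
    exact_mod_cast hcard
  have hex : ∀ C : 𝒟, ∃ j : Fin m, (fun k => ω (k + j)) ∈ X.L m (C : Set ℕ) := fun C =>
    (exists_residue_mem_U (by omega) (hvis C C.2)).imp fun j hj => hreg C C.2 j hj
  choose f hf using hex
  have hinj : Function.Injective f := by
    intro C D hCD
    by_contra hne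
    exact Set.disjoint_left.mp (disjoint_L (hd C.2 D.2 (Subtype.coe_injective.ne hne)))
      (hf C) (hCD ▸ hf D)
  have hbij : Function.Bijective f :=
    (Fintype.bijective_iff_injective_and_card f).mpr ⟨hinj, by rw [hcard', Fintype.card_fin]⟩
  obtain ⟨g, hgl, hgr⟩ := Function.bijective_iff_has_inverse.mp hbij
  have hg : ∀ j : Fin m, ∃ K, ∀ k, K ≤ k → ω (k * m + j) ∈ (g j : Set ℕ) := by
    intro j
    have := hf (g j)
    rwa [hgr j] at this
  choose K hK using hg
  have hm0 : 0 < m := by omega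
  have hlarge : ∀ n, (Finset.univ.sup K) * m ≤ n →
      ω n ∈ (g ⟨n % m, Nat.mod_lt n hm0⟩ : Set ℕ) := by
    intro n hn
    have := hK ⟨n % m, Nat.mod_lt n hm0⟩ (n / m)
      ((Finset.le_sup (Finset.mem_univ _)).trans ((Nat.le_div_iff_mul_le hm0).mpr hn))
    rwa [mul_comm, Nat.div_add_mod] at this
  have hne : ∀ n d, (Finset.univ.sup K) * m ≤ n → 0 < d → d < m → ω (n + d) ≠ ω n := by
    intro n d hn hd0 hdm he
    have h1 := hlarge n hn
    have h2 := hlarge (n + d) (by omega)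
    rw [he] at h2
    have h3 : g ⟨n % m, Nat.mod_lt n hm0⟩ = g ⟨(n + d) % m, Nat.mod_lt _ hm0⟩ := by
      by_contra hne
      exact Set.disjoint_left.mp
        (hd (Subtype.prop _) (Subtype.prop _) (Subtype.coe_injective.ne hne)) h1 h2
    have h4 := congrArg f h3
    rw [hgr, hgr, Fin.mk.injEq] at h4
    have h5 : n + 0 ≡ n + d [MOD m] := h4
    have h6 := Nat.ModEq.add_left_cancel' n h5
    have := (Nat.modEq_zero_iff_dvd.mp h6.symm)
    exact absurd (Nat.le_of_dvd hd0 this) (by omega)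
  exact eventually_up hup hdown fun n hn =>
    ⟨hne n 1 hn (by omega) (by omega), hne n 2 hn (by omega) (by omega)⟩

end Paths

section BirthDeath

variable {X : MarkovChain ℕ}

theorem IsBirthDeath.ae_skipFree (hbd : X.IsBirthDeath) :
    ∀ᵐ ω ∂X.μ, (∀ n, ω (n + 1) ≤ ω n + 1) ∧ ∀ n, ω n ≤ ω (n + 1) + 1 := by
  filter_upwards [X.ae_P_pos] with ω hω
  have : ∀ n, |(ω n : ℤ) - (ω (n + 1) : ℤ)| ≤ 1 := by
    intro n
    by_contra! h
    exact (hω n).ne' (hbd.tridiagonal _ _ h)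
  constructor <;> intro n <;> have := abs_le.mp (this n) <;> omega

theorem IsBirthDeath.ae_dichotomy (hbd : X.IsBirthDeath) :
    ∀ᵐ ω ∂X.μ, (∀ i, ∃ᶠ n in atTop, ω n = i) ∨ Tendsto ω atTop atTop := by
  have h1 := ae_all_iff.mpr fun i => X.ae_frequently_of_pos (hbd.birth_pos i)
  have h2 := ae_all_iff.mpr fun i => X.ae_frequently_of_pos (hbd.death_pos i)
  filter_upwards [h1, h2] with ω hup hdown
  by_cases hex : ∃ i, ∃ᶠ n in atTop, ω n = i
  · left
    obtain ⟨i, hi⟩ := hex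
    have h0 : ∃ᶠ n in atTop, ω n = 0 := by
      induction i with
      | zero => exact hi
      | succ i ih => exact ih (hdown i hi)
    intro j
    induction j with
    | zero => exact h0
    | succ j ih => exact hup j ih
  · right
    push Not at hex
    refine tendsto_atTop.mpr fun b => ?_
    have h3 : ∀ i ∈ Finset.range b, ∀ᶠ n in atTop, ω n ≠ i := fun i _ => hex i
    filter_upwards [(Finset.eventually_all _).mpr h3] with n hn
    by_contra! hlt
    exact hn _ (Finset.mem_range.mpr hlt) rfl

theorem IsBirthDeath.ae_shift_regular (hbd : X.IsBirthDeath) {m : ℕ} (hm : 1 ≤ m) {C : Set ℕ}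
    (hC : X.Regular m C) (j : ℕ) :
    ∀ᵐ ω ∂X.μ, (fun k => ω (k + j)) ∈ X.U m C → (fun k => ω (k + j)) ∈ X.L m C := by
  have h0 : X.μ (X.U m C \ X.L m C) = 0 := by
    rw [measure_eq_zero_iff_ae_notMem]
    filter_upwards [regular_iff.mp hC] with ω h1 h2
    exact h2.2 (h1 h2.1)
  have := hbd.μ_shift_null hm ((measurableSet_U m C).diff (measurableSet_L m C)) h0 ?_ j
  · filter_upwards [measure_eq_zero_iff_ae_notMem.mp this] with ω h1 h2
    by_contra h3
    exact h1 ⟨h2, h3⟩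
  · rintro ω t ⟨h1, h2⟩
    refine ⟨fun n => ?_, ?_⟩
    · obtain ⟨k, hk, hk'⟩ := h1 n
      exact ⟨k + t, by omega, by rwa [add_mul]⟩
    · rintro ⟨n, hn⟩
      refine h2 ⟨n, fun k hk => ?_⟩
      have := hn (k + t) (by omega)
      rwa [add_mul] at this

theorem frequently_mem_of_mem_U {ω : ℕ → ℕ} {m : ℕ} (hm : 1 ≤ m) {C : Set ℕ} (h : ω ∈ X.U m C) :
    ∃ᶠ n in atTop, ω n ∈ C := by
  refine frequently_atTop.mpr fun N => ?_
  obtain ⟨k, hk, hk'⟩ := h N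
  exact ⟨k * m, hk.trans (Nat.le_mul_of_pos_right k hm), hk'⟩

theorem infinite_of_not_transient {m : ℕ} (hm : 1 ≤ m) {C : Set ℕ}
    (htend : ∀ᵐ ω ∂X.μ, Tendsto ω atTop atTop) (hC : ¬ X.Transient m C) : C.Infinite := by
  intro hfin
  refine hC (transient_iff.mpr ?_)
  filter_upwards [htend] with ω h1 h2
  obtain ⟨b, hb⟩ := hfin.bddAbove
  obtain ⟨n, hn, hn'⟩ := ((frequently_mem_of_mem_U hm h2).and_eventually
    (h1.eventually_gt_atTop b)).exists
  exact absurd (hb hn) (not_le.mpr hn')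

theorem nonempty_of_not_transient {m : ℕ} {C : Set ℕ} (hC : ¬ X.Transient m C) :
    C.Nonempty := by
  by_contra h
  rw [not_nonempty_iff_eq_empty] at h
  subst h
  refine hC (transient_iff.mpr (ae_of_all _ fun ω hω => ?_))
  obtain ⟨k, -, hk⟩ := hω 0
  exact hk

theorem IsBirthDeath.eventually_up_of_beta (hbd : X.IsBirthDeath) {m : ℕ} (hm : 3 ≤ m)
    (hβ : X.beta m = m) : ∀ᵐ ω ∂X.μ, ∃ M, ∀ n ≥ M, ω (n + 1) = ω n + 1 := by
  have hne : (Set.encard '' {𝒞 : Set (Set ℕ) | X.IsBlackwell m 𝒞}).Nonempty := by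
    by_contra h
    rw [not_nonempty_iff_eq_empty] at h
    rw [beta, h, sInf_empty] at hβ
    exact ENat.top_ne_natCast m hβ
  obtain ⟨𝒟, h𝒟, hcard⟩ := csInf_mem hne
  replace hcard : 𝒟.encard = m := hcard.trans hβ
  have hreg : ∀ᵐ ω ∂X.μ, ∀ C ∈ 𝒟, ∀ j : ℕ,
      (fun k => ω (k + j)) ∈ X.U m C → (fun k => ω (k + j)) ∈ X.L m C :=
    (ae_ball_iff h𝒟.countable).mpr fun C hC => ae_all_iff.mpr fun j =>
      hbd.ae_shift_regular (by omega) (h𝒟.almostClosed C hC).1 j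
  have htend : ∀ᵐ ω ∂X.μ, Tendsto ω atTop atTop := by
    filter_upwards [hbd.ae_skipFree, hbd.ae_dichotomy, hreg] with ω ⟨hup, hdown⟩ hdic hreg
    refine hdic.resolve_left fun hall => ?_
    obtain ⟨M, hM⟩ := eventually_up_of_encard hm hcard h𝒟.disjoint hup hdown hreg fun C hC => by
      obtain ⟨c, hc⟩ := nonempty_of_not_transient (h𝒟.almostClosed C hC).2
      exact (hall c).mono fun n hn => hn ▸ hc
    have hge : ∀ n ≥ M, ω M ≤ ω n := by
      intro n hn
      induction n, hn using Nat.le_induction with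
      | base => exact le_rfl
      | succ n hn ih => rw [hM n hn]; omega
    obtain ⟨n, hn, hn'⟩ := frequently_atTop.mp (hall (ω M)) (M + 1)
    have h1 := hge (n - 1) (by omega)
    have h2 := hM (n - 1) (by omega)
    rw [show n - 1 + 1 = n by omega] at h2
    omega
  filter_upwards [hbd.ae_skipFree, hbd.ae_dichotomy, hreg] with ω ⟨hup, hdown⟩ hdic hreg
  exact eventually_up_of_encard hm hcard h𝒟.disjoint hup hdown hreg fun C hC =>
    frequently_mem_of_infinite hup hdic
      (infinite_of_not_transient (by omega) htend (h𝒟.almostClosed C hC).2)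

theorem mem_U_one {ω : ℕ → ℕ} {C : Set ℕ} : ω ∈ X.U 1 C ↔ ∃ᶠ n in atTop, ω n ∈ C := by
  simp [U, frequently_atTop]

theorem IsBirthDeath.beta_one (hbd : X.IsBirthDeath) : X.beta 1 = 1 := by
  have huniv : ∀ ω, ω ∈ X.L 1 univ := fun ω => ⟨0, fun _ _ => mem_univ _⟩
  have hac : X.AlmostClosed 1 univ := by
    refine ⟨regular_iff.mpr (ae_of_all _ fun ω _ => huniv ω), fun h => ?_⟩
    obtain ⟨ω, hω⟩ := (transient_iff.mp h).exists
    exact hω (L_subset_U (huniv ω))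
  have hat : X.Atomic 1 univ := by
    refine ⟨hac, ?_⟩
    rintro ⟨A, B, -, -, hAB, hA, hB⟩
    have hcontra : ∀ᵐ ω ∂X.μ, ω ∈ X.U 1 A → ω ∈ X.U 1 B → False := by
      filter_upwards [regular_iff.mp hA.1, regular_iff.mp hB.1] with ω h1 h2 h3 h4
      exact Set.disjoint_left.mp (disjoint_L hAB) (h1 h3) (h2 h4)
    have htend : ∀ᵐ ω ∂X.μ, Tendsto ω atTop atTop := by
      filter_upwards [hbd.ae_dichotomy, hcontra] with ω hdic hc
      refine hdic.resolve_left fun hall => ?_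
      obtain ⟨a, ha⟩ := nonempty_of_not_transient hA.2
      obtain ⟨b, hb⟩ := nonempty_of_not_transient hB.2
      exact hc (mem_U_one.mpr ((hall a).mono fun n hn => hn ▸ ha))
        (mem_U_one.mpr ((hall b).mono fun n hn => hn ▸ hb))
    have : ∀ᵐ ω ∂X.μ, False := by
      filter_upwards [hbd.ae_skipFree, hbd.ae_dichotomy, hcontra] with ω ⟨hup, _⟩ hdic hc
      exact hc
        (mem_U_one.mpr (frequently_mem_of_infinite hup hdic
          (infinite_of_not_transient le_rfl htend hA.2)))
        (mem_U_one.mpr (frequently_mem_of_infinite hup hdic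
          (infinite_of_not_transient le_rfl htend hB.2)))
    exact this.exists.elim fun _ h => h
  have hBl : X.IsBlackwell 1 {univ} := isBlackwell_of_atomic (countable_singleton _)
    (fun C hC => by rwa [mem_singleton_iff.mp hC]) (pairwiseDisjoint_singleton _ _)
    (ae_of_all _ fun ω => ⟨univ, rfl, huniv ω⟩)
  rw [hBl.beta_eq fun C hC => by rwa [mem_singleton_iff.mp hC], encard_singleton]

/-- The states congruent to `r` modulo `m`. -/
def residueClass (m r : ℕ) : Set ℕ := {i | i % m = r}

theorem disjoint_residueClass {m r s : ℕ} (h : r ≠ s) :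
    Disjoint (residueClass m r) (residueClass m s) :=
  Set.disjoint_left.mpr fun _ h1 h2 => h (h1.symm.trans h2)

theorem add_of_up {ω : ℕ → ℕ} {M : ℕ} (h : ∀ n ≥ M, ω (n + 1) = ω n + 1) {a : ℕ} (ha : M ≤ a)
    (d : ℕ) : ω (a + d) = ω a + d := by
  induction d with
  | zero => rfl
  | succ d ih => rw [← add_assoc, h _ (by omega), ih, add_assoc]

theorem mem_L_residueClass {ω : ℕ → ℕ} {M m K : ℕ} (hm : 1 ≤ m)
    (h : ∀ n ≥ M, ω (n + 1) = ω n + 1) (hK : M ≤ K) :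
    ω ∈ X.L m (residueClass m (ω (K * m) % m)) := by
  refine ⟨K, fun k hk => ?_⟩
  obtain ⟨d, rfl⟩ := Nat.exists_eq_add_of_le hk
  change ω ((K + d) * m) % m = _
  rw [add_mul, add_of_up h (hK.trans (Nat.le_mul_of_pos_right K hm)), Nat.add_mul_mod_self_right]

theorem mem_U_of_infinite_subset_residueClass {ω : ℕ → ℕ} {M m r : ℕ} (hm : 1 ≤ m)
    (h : ∀ n ≥ M, ω (n + 1) = ω n + 1) (hr : ω ∈ X.L m (residueClass m r)) {A : Set ℕ}
    (hA : A.Infinite) (hAr : A ⊆ residueClass m r) : ω ∈ X.U m A := by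
  intro n
  obtain ⟨K, hK⟩ := hr
  set K' := max (max K n) M
  have hKK : K ≤ K' := (le_max_left _ _).trans (le_max_left _ _)
  have hnK : n ≤ K' := (le_max_right _ _).trans (le_max_left _ _)
  have hMK : M ≤ K' := le_max_right _ _
  obtain ⟨a, ha, hlt⟩ := hA.exists_gt (ω (K' * m))
  have h1 : ω (K' * m) ≡ a [MOD m] := (hK K' hKK).trans (hAr ha).symm
  obtain ⟨d, hd⟩ := (Nat.modEq_iff_dvd' hlt.le).mp h1
  refine ⟨K' + d, by omega, ?_⟩
  rw [add_mul, add_of_up h (hMK.trans (Nat.le_mul_of_pos_right K' hm)), mul_comm d m, ← hd,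
    Nat.add_sub_cancel' hlt.le]
  exact ha

theorem IsBirthDeath.almostClosed_residueClass (hbd : X.IsBirthDeath)
    (hup : ∀ᵐ ω ∂X.μ, ∃ M, ∀ n ≥ M, ω (n + 1) = ω n + 1) {m r : ℕ} (hr : r < m) :
    X.AlmostClosed m (residueClass m r) := by
  have hm : 1 ≤ m := by omega
  refine ⟨regular_iff.mpr ?_, fun ht => ?_⟩
  · filter_upwards [hup] with ω ⟨M, hM⟩ hU
    obtain ⟨K, hK, hKr⟩ := hU M
    have := mem_L_residueClass (X := X) hm hM hK
    rwa [show ω (K * m) % m = r from hKr] at this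
  · have h1 : ∀ᵐ ω ∂X.μ, ∀ j, (fun k => ω (k + j)) ∉ X.U m (residueClass m r) := by
      refine ae_all_iff.mpr fun j => ?_
      refine measure_eq_zero_iff_ae_notMem.mp
        (hbd.μ_shift_null hm (measurableSet_U m _) ht (fun ω t h n => ?_) j)
      obtain ⟨k, hk, hk'⟩ := h n
      exact ⟨k + t, by omega, by rwa [add_mul]⟩
    obtain ⟨ω, h2, M, hM⟩ := (h1.and hup).exists
    have hlt := Nat.mod_lt (ω (M * m)) hm
    refine h2 (r + (m - ω (M * m) % m)) fun n => ⟨M + n, by omega, ?_⟩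
    change ω ((M + n) * m + _) % m = r
    rw [add_mul, add_assoc, add_of_up hM (Nat.le_mul_of_pos_right M hm)]
    have h3 := Nat.div_add_mod (ω (M * m)) m
    have h4 : ω (M * m) + (n * m + (r + (m - ω (M * m) % m)))
        = r + (ω (M * m) / m + n + 1) * m := by
      rw [add_mul, add_mul, mul_comm (ω (M * m) / m) m]
      omega
    rw [h4, Nat.add_mul_mod_self_right, Nat.mod_eq_of_lt hr]

theorem IsBirthDeath.atomic_residueClass (hbd : X.IsBirthDeath)
    (hup : ∀ᵐ ω ∂X.μ, ∃ M, ∀ n ≥ M, ω (n + 1) = ω n + 1) {m r : ℕ} (hr : r < m) :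
    X.Atomic m (residueClass m r) := by
  have hm : 1 ≤ m := by omega
  have hac := hbd.almostClosed_residueClass hup hr
  have htend : ∀ᵐ ω ∂X.μ, Tendsto ω atTop atTop := by
    filter_upwards [hup] with ω ⟨M, hM⟩
    refine tendsto_atTop.mpr fun b => ?_
    filter_upwards [eventually_ge_atTop (M + b)] with n hn
    have := add_of_up hM (le_refl M) (n - M)
    rw [Nat.add_sub_cancel' (by omega)] at this
    omega
  refine ⟨hac, ?_⟩
  rintro ⟨A, B, hAr, hBr, hAB, hA, hB⟩
  refine hac.μ_L_ne_zero (measure_eq_zero_iff_ae_notMem.mpr ?_)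
  filter_upwards [hup, regular_iff.mp hA.1, regular_iff.mp hB.1] with ω ⟨M, hM⟩ h1 h2 hL
  exact Set.disjoint_left.mp (disjoint_L hAB)
    (h1 (mem_U_of_infinite_subset_residueClass hm hM hL
      (infinite_of_not_transient hm htend hA.2) hAr))
    (h2 (mem_U_of_infinite_subset_residueClass hm hM hL
      (infinite_of_not_transient hm htend hB.2) hBr))

theorem IsBirthDeath.beta_eq_of_up (hbd : X.IsBirthDeath)
    (hup : ∀ᵐ ω ∂X.μ, ∃ M, ∀ n ≥ M, ω (n + 1) = ω n + 1) {m : ℕ} (hm : 1 ≤ m) :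
    X.beta m = m := by
  have hinj : Function.Injective fun r : Fin m => residueClass m r := by
    intro r s h
    have h1 : (r : ℕ) ∈ residueClass m r := Nat.mod_eq_of_lt r.2
    have h2 : (r : ℕ) ∈ residueClass m s := by
      have h' : residueClass m r = residueClass m s := h
      rwa [← h']
    exact Fin.ext (h1.symm.trans h2)
  have hat : ∀ C ∈ range fun r : Fin m => residueClass m r, X.Atomic m C := by
    rintro _ ⟨r, rfl⟩
    exact hbd.atomic_residueClass hup r.2
  have hBl : X.IsBlackwell m (range fun r : Fin m => residueClass m r) := by
    refine isBlackwell_of_atomic (countable_range _) hat ?_ ?_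
    · rintro _ ⟨r, rfl⟩ _ ⟨s, rfl⟩ hne
      exact disjoint_residueClass fun h => hne (by simp only [h])
    · filter_upwards [hup] with ω ⟨M, hM⟩
      exact ⟨_, ⟨⟨ω (M * m) % m, Nat.mod_lt _ hm⟩, rfl⟩, mem_L_residueClass hm hM le_rfl⟩
  rw [hBl.beta_eq hat, ← image_univ, hinj.encard_image, encard_univ, ENat.card_eq_coe_fintype_card,
    Fintype.card_fin]

end BirthDeath

end MarkovChain

/-- The asymptotic period `d(X)` of a birth-death process `X`
equals `1`, `2` or `∞`. -/
theorem stmt14 (X : MarkovChain ℕ) (hbd : X.IsBirthDeath)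
    (hirr : X.Irreducible) (hap : X.Aperiodic) :
    X.period = 1 ∨ X.period = 2 ∨ X.period = ⊤ := by
  have h1 : (1 : ℕ∞) ≤ X.period :=
    le_sSup ⟨1, le_rfl, by rw [hbd.beta_one, Nat.cast_one], by rw [Nat.cast_one]⟩
  by_cases hex : ∃ m : ℕ, 3 ≤ m ∧ X.beta m = m
  · obtain ⟨m, hm, hβ⟩ := hex
    have hup := hbd.eventually_up_of_beta hm hβ
    refine Or.inr (Or.inr (ENat.eq_top_iff_forall_ge.mpr fun k => ?_))
    refine le_trans ?_ (le_sSup ⟨k + 1, by omega, hbd.beta_eq_of_up hup (by omega), rfl⟩)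
    exact_mod_cast Nat.le_succ k
  · push Not at hex
    have h2 : X.period ≤ 2 := by
      refine sSup_le ?_
      rintro _ ⟨m, -, hβ, rfl⟩
      have : m ≤ 2 := by
        by_contra! h
        exact hex m h hβ
      exact_mod_cast this
    lift X.period to ℕ using ne_top_of_le_ne_top (by simp) h2 with d
    norm_cast at h1 h2 ⊢
    omega
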